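/- arXiv:0807.0620 — 3 statements merged into one kernel-verified Lean document; each statement's English description precedes it below -/
import Mathlib

section
/- With the groups G_t, G_t¹, H_t as defined, one has H_{t_i} = Γ⁰_p for i ∈ {1, 2, 5, 8} and H_{t_i} = Γ_{0,p} for i ∈ {3, 4, 6, 7}. -/
open Matrix

noncomputable section

variable (p : ℕ) [Fact p.Prime]

/-- The 4×4 symplectic similitude matrix `J`. -/
def Jmat : Matrix (Fin 4) (Fin 4) ℚ_[p] :=
  !![0,0,1,0; 0,0,0,1; -1,0,0,0; 0,-1,0,0]

/-- `GSp₄(ℚ_p)`. -/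
def GSp4 : Set (Matrix (Fin 4) (Fin 4) ℚ_[p]) :=
  {g | IsUnit g.det ∧ ∃ μ : ℚ_[p]ˣ, gᵀ * Jmat p * g = (μ : ℚ_[p]) • Jmat p}

/-- `K_p = GSp₄(ℤ_p)`, viewed inside `GSp₄(ℚ_p)`. -/
def Kp : Set (Matrix (Fin 4) (Fin 4) ℚ_[p]) :=
  {g | g ∈ GSp4 p ∧ (∀ i j, ‖g i j‖ ≤ 1) ∧ ‖g.det‖ = 1}

/-- The Iwahori subgroup `I_p`: elements of `K_p` whose reduction mod `p` has zero
entries at positions (1,2), (3,1), (3,2), (4,1), (4,2), (4,3) (0-indexed below). -/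
def Ip : Set (Matrix (Fin 4) (Fin 4) ℚ_[p]) :=
  {g | g ∈ Kp p ∧ ‖g 0 1‖ < 1 ∧ ‖g 2 0‖ < 1 ∧ ‖g 2 1‖ < 1 ∧
      ‖g 3 0‖ < 1 ∧ ‖g 3 1‖ < 1 ∧ ‖g 3 2‖ < 1}

/-- The matrix `U_x` for `x = (n,q,r)`. -/
def Umat (n q r : ℚ_[p]) : Matrix (Fin 4) (Fin 4) ℚ_[p] :=
  !![1,0,n,q; 0,1,q,r; 0,0,1,0; 0,0,0,1]

/-- The matrix `Z_y` for `y ∈ ℤ_p`. -/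
def Zmat (y : ℚ_[p]) : Matrix (Fin 4) (Fin 4) ℚ_[p] :=
  !![1,y,0,0; 0,1,0,0; 0,0,1,0; 0,0,-y,1]

/-- The matrix `Z_∞`. -/
def Zinf : Matrix (Fin 4) (Fin 4) ℚ_[p] :=
  !![0,1,0,0; 1,0,0,0; 0,0,0,1; 0,0,1,0]

/-- Assemble a 4×4 matrix from 2×2 blocks. -/
def blk (A B C D : Matrix (Fin 2) (Fin 2) ℚ_[p]) : Matrix (Fin 4) (Fin 4) ℚ_[p] :=
  Matrix.reindex finSumFinEquiv finSumFinEquiv (fromBlocks A B C D)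

variable (a b c : ℚ_[p])

/-- The matrix `S = (a, b/2; b/2, c)`. -/
def Smat : Matrix (Fin 2) (Fin 2) ℚ_[p] := !![a, b/2; b/2, c]

/-- The matrix `ξ = (b/2, c; −a, −b/2)`. -/
def xiS : Matrix (Fin 2) (Fin 2) ℚ_[p] := !![b/2, c; -a, -b/2]

/-- The torus `T(ℚ_p) = {g ∈ GL₂(ℚ_p) : gᵀSg = det(g)·S}`. -/
def Tgrp : Set (Matrix (Fin 2) (Fin 2) ℚ_[p]) :=
  {g | IsUnit g.det ∧ gᵀ * Smat p a b c * g = g.det • Smat p a b c}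

/-- The embedding `g ↦ diag(g, det(g)·(g⁻¹)ᵀ)` of `GL₂` into `GSp₄`. -/
def emb (g : Matrix (Fin 2) (Fin 2) ℚ_[p]) : Matrix (Fin 4) (Fin 4) ℚ_[p] :=
  blk p g 0 0 (g.det • (g⁻¹)ᵀ)

/-- The unipotent group `U(ℚ_p)`. -/
def Ugrp : Set (Matrix (Fin 4) (Fin 4) ℚ_[p]) :=
  {u | ∃ X : Matrix (Fin 2) (Fin 2) ℚ_[p], Xᵀ = X ∧ u = blk p 1 X 0 1}

/-- The Bessel group `R(ℚ_p) = T(ℚ_p)·U(ℚ_p)` inside `GSp₄(ℚ_p)`. -/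
def Rgrp : Set (Matrix (Fin 4) (Fin 4) ℚ_[p]) :=
  {r | ∃ t ∈ Tgrp p a b c, ∃ u ∈ Ugrp p, r = emb p t * u}

/-- `h(l,m) = diag(p^{2m+l}, p^{m+l}, 1, p^m)`. -/
def hmat (l : ℤ) (m : ℕ) : Matrix (Fin 4) (Fin 4) ℚ_[p] :=
  diagonal ![(p : ℚ_[p]) ^ (2 * (m : ℤ) + l), (p : ℚ_[p]) ^ ((m : ℤ) + l), 1, (p : ℚ_[p]) ^ (m : ℤ)]

/-- `(l,m)`-equivalence: `f ~ g` iff `r·h(l,m)·f·k = h(l,m)·g` for some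
`r ∈ R(ℚ_p)`, `k ∈ I_p`. -/
def LMEquiv (l : ℤ) (m : ℕ) (f g : Matrix (Fin 4) (Fin 4) ℚ_[p]) : Prop :=
  ∃ r ∈ Rgrp p a b c, ∃ k ∈ Ip p, r * hmat p l m * f * k = hmat p l m * g

/-- `t₁ = B_{(1,0,0)}^0`. -/
def t1 : Matrix (Fin 4) (Fin 4) ℚ_[p] := Jmat p * Umat p 1 0 0 * Jmat p * Zmat p 0
/-- `t₂ = B_{(1,0,0)}^∞`. -/
def t2 : Matrix (Fin 4) (Fin 4) ℚ_[p] := Jmat p * Umat p 1 0 0 * Jmat p * Zinf p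
/-- `t₃ = B_{(0,0,1)}^0`. -/
def t3 : Matrix (Fin 4) (Fin 4) ℚ_[p] := Jmat p * Umat p 0 0 1 * Jmat p * Zmat p 0
/-- `t₄ = B_{(0,0,1)}^∞`. -/
def t4 : Matrix (Fin 4) (Fin 4) ℚ_[p] := Jmat p * Umat p 0 0 1 * Jmat p * Zinf p
/-- `t₅ = B_{(0,0,0)}^0`. -/
def t5 : Matrix (Fin 4) (Fin 4) ℚ_[p] := Jmat p * Umat p 0 0 0 * Jmat p * Zmat p 0
/-- `t₆ = B_{(0,0,0)}^∞`. -/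
def t6 : Matrix (Fin 4) (Fin 4) ℚ_[p] := Jmat p * Umat p 0 0 0 * Jmat p * Zinf p
/-- `t₇ = A_{(0,0,0)}^0`. -/
def t7 : Matrix (Fin 4) (Fin 4) ℚ_[p] := Umat p 0 0 0 * Jmat p * Zmat p 0
/-- `t₈ = A_{(0,0,0)}^∞`. -/
def t8 : Matrix (Fin 4) (Fin 4) ℚ_[p] := Umat p 0 0 0 * Jmat p * Zinf p

/-- `T_m`: `{t₁,…,t₈}` if `m > 0`, and `{t₁, t₂, t₅, t₇}` if `m = 0`. -/
def TsetM (m : ℕ) : Set (Matrix (Fin 4) (Fin 4) ℚ_[p]) :=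
  if m = 0 then {t1 p, t2 p, t5 p, t7 p}
  else {t1 p, t2 p, t3 p, t4 p, t5 p, t6 p, t7 p, t8 p}

/-- `GL₂(ℤ_p)` viewed inside `GL₂(ℚ_p)`: integral entries and unit determinant. -/
def GL2Z : Set (Matrix (Fin 2) (Fin 2) ℚ_[p]) :=
  {g | (∀ i j, ‖g i j‖ ≤ 1) ∧ ‖g.det‖ = 1}

/-- `Γ⁰_p`: elements of `GL₂(ℤ_p)` that are lower triangular mod `p`. -/
def Gamma0upper : Set (Matrix (Fin 2) (Fin 2) ℚ_[p]) :=
  {g | g ∈ GL2Z p ∧ ‖g 0 1‖ < 1}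

/-- `Γ_{0,p}`: elements of `GL₂(ℤ_p)` that are upper triangular mod `p`. -/
def Gamma0lower : Set (Matrix (Fin 2) (Fin 2) ℚ_[p]) :=
  {g | g ∈ GL2Z p ∧ ‖g 1 0‖ < 1}

/-- `U(ℤ_p)`: unipotent matrices `(1, X; 0, 1)` with `X` symmetric integral. -/
def UZ : Set (Matrix (Fin 4) (Fin 4) ℚ_[p]) :=
  {u | ∃ X : Matrix (Fin 2) (Fin 2) ℚ_[p], Xᵀ = X ∧ (∀ i j, ‖X i j‖ ≤ 1) ∧
    u = blk p 1 X 0 1}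

/-- The product set `U(ℤ_p)·GL₂(ℤ_p)` inside `GSp₄(ℚ_p)`. -/
def UGL : Set (Matrix (Fin 4) (Fin 4) ℚ_[p]) :=
  {m | ∃ u ∈ UZ p, ∃ g ∈ GL2Z p, m = u * emb p g}

/-- `G_t = t⁻¹·U(ℤ_p)GL₂(ℤ_p)·t ∩ I_p`. -/
def Gt (t : Matrix (Fin 4) (Fin 4) ℚ_[p]) : Set (Matrix (Fin 4) (Fin 4) ℚ_[p]) :=
  {x | (∃ m ∈ UGL p, x = t⁻¹ * m * t) ∧ x ∈ Ip p}

/-- `G_t¹ = t·G_t·t⁻¹`. -/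
def Gt1 (t : Matrix (Fin 4) (Fin 4) ℚ_[p]) : Set (Matrix (Fin 4) (Fin 4) ℚ_[p]) :=
  {x | ∃ y ∈ Gt p t, x = t * y * t⁻¹}

/-- `H_t = {x ∈ GL₂(ℤ_p) : y·x ∈ G_t¹ for some y ∈ U(ℤ_p)}`. -/
def Ht (t : Matrix (Fin 4) (Fin 4) ℚ_[p]) : Set (Matrix (Fin 2) (Fin 2) ℚ_[p]) :=
  {x | x ∈ GL2Z p ∧ ∃ y ∈ UZ p, y * emb p x ∈ Gt1 p t}

lemma succAbove_two_two : Fin.succAbove (2 : Fin 4) 2 = 3 := rfl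

lemma succAbove_one_two : Fin.succAbove (1 : Fin 4) 2 = 3 := rfl

lemma norm_sum_mul_le_one {ι : Type*} [Fintype ι] {f g : ι → ℚ_[p]}
    (hf : ∀ i, ‖f i‖ ≤ 1) (hg : ∀ i, ‖g i‖ ≤ 1) : ‖∑ i, f i * g i‖ ≤ 1 :=
  IsUltrametricDist.norm_sum_le_of_forall_le_of_nonneg zero_le_one fun i _ => by
    rw [norm_mul]; exact mul_le_one₀ (hf i) (norm_nonneg _) (hg i)

lemma norm_sub_le_max (x y : ℚ_[p]) : ‖x - y‖ ≤ max ‖x‖ ‖y‖ := by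
  simpa [sub_eq_add_neg] using Padic.nonarchimedean x (-y)

lemma norm_sub_le_one {x y : ℚ_[p]} (hx : ‖x‖ ≤ 1) (hy : ‖y‖ ≤ 1) : ‖x - y‖ ≤ 1 :=
  (norm_sub_le_max p x y).trans (max_le hx hy)

lemma norm_mul_lt_one {x y : ℚ_[p]} (hx : ‖x‖ ≤ 1) (hy : ‖y‖ < 1) : ‖x * y‖ < 1 := by
  rw [norm_mul]; exact mul_lt_one_of_nonneg_of_lt_one_right hx (norm_nonneg _) hy

lemma norm_div_le_one {x y : ℚ_[p]} (hx : ‖x‖ ≤ 1) (hy : ‖y‖ = 1) : ‖x / y‖ ≤ 1 := by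
  rwa [norm_div, hy, div_one]

lemma mul_mem_Kp {g h : Matrix (Fin 4) (Fin 4) ℚ_[p]} (hg : g ∈ Kp p) (hh : h ∈ Kp p) :
    g * h ∈ Kp p := by
  obtain ⟨⟨hgu, μ, hμ⟩, hgn, hgd⟩ := hg
  obtain ⟨⟨hhu, ν, hν⟩, hhn, hhd⟩ := hh
  refine ⟨⟨by rw [det_mul]; exact hgu.mul hhu, μ * ν, ?_⟩, fun i j => ?_, by simp [det_mul, *]⟩
  · calc (g * h)ᵀ * Jmat p * (g * h) = hᵀ * (gᵀ * Jmat p * g) * h := by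
          simp only [transpose_mul, Matrix.mul_assoc]
      _ = _ := by rw [hμ, Matrix.mul_smul, Matrix.smul_mul, hν, smul_smul, Units.val_mul]
  · exact norm_sum_mul_le_one p (hgn i) fun k => hhn k j

lemma inv_mem_Kp {g : Matrix (Fin 4) (Fin 4) ℚ_[p]} (hg : g ∈ Kp p) : g⁻¹ ∈ Kp p := by
  obtain ⟨⟨hgu, μ, hμ⟩, hgn, hgd⟩ := hg
  refine ⟨⟨isUnit_nonsing_inv_det g hgu, μ⁻¹, ?_⟩, fun i j => ?_, ?_⟩
  · have h : (g⁻¹)ᵀ * (gᵀ * Jmat p * g) * g⁻¹ = Jmat p := by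
      rw [Matrix.mul_assoc, Matrix.mul_assoc (gᵀ * Jmat p), mul_nonsing_inv g hgu, Matrix.mul_one,
        ← Matrix.mul_assoc, ← transpose_mul, mul_nonsing_inv g hgu, transpose_one, Matrix.one_mul]
    rw [hμ, Matrix.mul_smul, Matrix.smul_mul] at h
    rw [← h, smul_smul, ← Units.val_mul, inv_mul_cancel, Units.val_one, one_smul, h]
  · let G : Matrix (Fin 4) (Fin 4) ℤ_[p] := fun i j => ⟨g i j, hgn i j⟩
    have hG : G.map (PadicInt.Coe.ringHom (p := p)) = g := rfl
    have hadj : g.adjugate i j = (G.adjugate i j : ℚ_[p]) := by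
      rw [← hG]
      exact congrFun₂ ((PadicInt.Coe.ringHom (p := p)).map_adjugate G).symm i j
    rw [inv_def, Ring.inverse_eq_inv', Matrix.smul_apply, smul_eq_mul, norm_mul, norm_inv, hgd,
      inv_one, one_mul, hadj]
    exact PadicInt.norm_le_one _
  · rw [det_nonsing_inv, Ring.inverse_eq_inv', norm_inv, hgd, inv_one]

lemma Jmat_mem_Kp : Jmat p ∈ Kp p := by
  have hdet : (Jmat p).det = 1 := by
    simp [succAbove_two_two, Jmat, det_succ_row_zero, Fin.sum_univ_succ]
  refine ⟨⟨by simp [hdet], 1, ?_⟩, fun i j => ?_, by simp [hdet]⟩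
  · ext i j
    fin_cases i <;> fin_cases j <;> simp [Jmat, Matrix.mul_apply, Fin.sum_univ_succ]
  · fin_cases i <;> fin_cases j <;> simp [Jmat]

lemma Umat_mem_Kp {n q r : ℚ_[p]} (hn : ‖n‖ ≤ 1) (hq : ‖q‖ ≤ 1) (hr : ‖r‖ ≤ 1) :
    Umat p n q r ∈ Kp p := by
  have hdet : (Umat p n q r).det = 1 := by simp [Umat, det_succ_row_zero, Fin.sum_univ_succ]
  refine ⟨⟨by simp [hdet], 1, ?_⟩, fun i j => ?_, by simp [hdet]⟩
  · ext i j
    fin_cases i <;> fin_cases j <;> simp [Jmat, Umat, Matrix.mul_apply, Fin.sum_univ_succ]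
  · fin_cases i <;> fin_cases j <;> simp [Umat, *]

lemma Zmat_mem_Kp {y : ℚ_[p]} (hy : ‖y‖ ≤ 1) : Zmat p y ∈ Kp p := by
  have hdet : (Zmat p y).det = 1 := by simp [Zmat, det_succ_row_zero, Fin.sum_univ_succ]
  refine ⟨⟨by simp [hdet], 1, ?_⟩, fun i j => ?_, by simp [hdet]⟩
  · ext i j
    fin_cases i <;> fin_cases j <;> simp [Jmat, Zmat, Matrix.mul_apply, Fin.sum_univ_succ]
  · fin_cases i <;> fin_cases j <;> simp [Zmat, hy]

lemma Zinf_mem_Kp : Zinf p ∈ Kp p := by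
  have hdet : (Zinf p).det = 1 := by
    simp [succAbove_one_two, Zinf, det_succ_row_zero, Fin.sum_univ_succ]
  refine ⟨⟨by simp [hdet], 1, ?_⟩, fun i j => ?_, by simp [hdet]⟩
  · ext i j
    fin_cases i <;> fin_cases j <;> simp [Jmat, Zinf, Matrix.mul_apply, Fin.sum_univ_succ]
  · fin_cases i <;> fin_cases j <;> simp [Zinf]

/-- The image of `g` under `emb`, without reference to `g⁻¹`. -/
lemma emb_eq {g : Matrix (Fin 2) (Fin 2) ℚ_[p]} (hg : g ∈ GL2Z p) :
    emb p g = !![g 0 0, g 0 1, 0, 0; g 1 0, g 1 1, 0, 0;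
      0, 0, g 1 1, -g 1 0; 0, 0, -g 0 1, g 0 0] := by
  have h0 : g.det ≠ 0 := norm_ne_zero_iff.1 (hg.2 ▸ one_ne_zero)
  have h : g.det • (g⁻¹)ᵀ = g.adjugateᵀ := by
    rw [inv_def, Ring.inverse_eq_inv', transpose_smul, smul_smul, mul_inv_cancel₀ h0, one_smul]
  rw [emb, h]
  ext i j
  fin_cases i <;> fin_cases j <;> simp [blk, adjugate_fin_two, finSumFinEquiv, Fin.addCases]

lemma emb_mem_Kp {g : Matrix (Fin 2) (Fin 2) ℚ_[p]} (hg : g ∈ GL2Z p) : emb p g ∈ Kp p := by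
  have h0 : g.det ≠ 0 := norm_ne_zero_iff.1 (hg.2 ▸ one_ne_zero)
  have hdet : (emb p g).det = g.det ^ 2 := by
    rw [emb_eq p hg, det_fin_two]
    simp [det_succ_row_zero, Fin.sum_univ_succ, succAbove_one_two]
    ring
  refine ⟨⟨by simp [hdet, h0], Units.mk0 g.det h0, ?_⟩, fun i j => ?_, by simp [hdet, hg.2]⟩
  · rw [emb_eq p hg, Units.val_mk0, det_fin_two]
    ext i j
    fin_cases i <;> fin_cases j <;> simp [Jmat, Matrix.mul_apply, Fin.sum_univ_succ] <;> ring
  · rw [emb_eq p hg]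
    fin_cases i <;> fin_cases j <;> simp [hg.1]

lemma mem_UZ_iff {u : Matrix (Fin 4) (Fin 4) ℚ_[p]} :
    u ∈ UZ p ↔ ∃ n q r : ℚ_[p], ‖n‖ ≤ 1 ∧ ‖q‖ ≤ 1 ∧ ‖r‖ ≤ 1 ∧ u = Umat p n q r := by
  constructor
  · rintro ⟨X, hX, hn, rfl⟩
    refine ⟨X 0 0, X 0 1, X 1 1, hn _ _, hn _ _, hn _ _, ?_⟩
    have h : X 1 0 = X 0 1 := congrFun₂ hX 0 1
    ext i j
    fin_cases i <;> fin_cases j <;> simp [blk, Umat, finSumFinEquiv, Fin.addCases, h]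
  · rintro ⟨n, q, r, hn, hq, hr, rfl⟩
    refine ⟨!![n, q; q, r], ?_, fun i j => ?_, ?_⟩
    · ext i j
      fin_cases i <;> fin_cases j <;> simp
    · fin_cases i <;> fin_cases j <;> simp [*]
    · ext i j
      fin_cases i <;> fin_cases j <;> simp [blk, Umat, finSumFinEquiv, Fin.addCases]

/-- The congruences mod `p` that cut out `I_p` inside `K_p`. -/
def IsIwahoriMod (g : Matrix (Fin 4) (Fin 4) ℚ_[p]) : Prop :=
  ‖g 0 1‖ < 1 ∧ ‖g 2 0‖ < 1 ∧ ‖g 2 1‖ < 1 ∧ ‖g 3 0‖ < 1 ∧ ‖g 3 1‖ < 1 ∧ ‖g 3 2‖ < 1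

/-- The product of `Umat p n q r` with the image of `g` under `emb`. -/
def siegelMat (g : Matrix (Fin 2) (Fin 2) ℚ_[p]) (n q r : ℚ_[p]) : Matrix (Fin 4) (Fin 4) ℚ_[p] :=
  !![g 0 0, g 0 1, n * g 1 1 - q * g 0 1, q * g 0 0 - n * g 1 0;
    g 1 0, g 1 1, q * g 1 1 - r * g 0 1, r * g 0 0 - q * g 1 0;
    0, 0, g 1 1, -g 1 0; 0, 0, -g 0 1, g 0 0]

lemma Umat_mul_emb {g : Matrix (Fin 2) (Fin 2) ℚ_[p]} (hg : g ∈ GL2Z p) (n q r : ℚ_[p]) :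
    Umat p n q r * emb p g = siegelMat p g n q r := by
  rw [emb_eq p hg]
  ext i j
  fin_cases i <;> fin_cases j <;>
    simp [Umat, siegelMat, Matrix.mul_apply, Fin.sum_univ_succ] <;> ring

lemma mem_Ht_iff {s t : Matrix (Fin 4) (Fin 4) ℚ_[p]} (ht : t ∈ Kp p) (hst : s * t = 1)
    {g : Matrix (Fin 2) (Fin 2) ℚ_[p]} :
    g ∈ Ht p t ↔ g ∈ GL2Z p ∧ ∃ n q r : ℚ_[p], ‖n‖ ≤ 1 ∧ ‖q‖ ≤ 1 ∧ ‖r‖ ≤ 1 ∧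
      IsIwahoriMod p (s * siegelMat p g n q r * t) := by
  have hs : t⁻¹ = s := inv_eq_left_inv hst
  have hts : t * s = 1 := mul_eq_one_comm.1 hst
  refine and_congr_right fun hg => ⟨?_, ?_⟩
  · rintro ⟨u, hu, x, ⟨-, hx⟩, hux⟩
    obtain ⟨n, q, r, hn, hq, hr, rfl⟩ := (mem_UZ_iff p).1 hu
    refine ⟨n, q, r, hn, hq, hr, ?_⟩
    have : s * (t * x * t⁻¹) * t = x := by
      rw [hs, Matrix.mul_assoc, Matrix.mul_assoc, hst, Matrix.mul_one, ← Matrix.mul_assoc, hst,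
        Matrix.one_mul]
    rw [← Umat_mul_emb p hg, hux, this]
    exact hx.2
  · rintro ⟨n, q, r, hn, hq, hr, h⟩
    have hu : Umat p n q r ∈ UZ p := (mem_UZ_iff p).2 ⟨n, q, r, hn, hq, hr, rfl⟩
    refine ⟨_, hu, t⁻¹ * (Umat p n q r * emb p g) * t, ⟨⟨_, ⟨_, hu, g, hg, rfl⟩, rfl⟩, ?_, ?_⟩, ?_⟩
    · exact mul_mem_Kp p (mul_mem_Kp p (inv_mem_Kp p ht)
        (mul_mem_Kp p (Umat_mem_Kp p hn hq hr) (emb_mem_Kp p hg))) ht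
    · rw [hs, Umat_mul_emb p hg]
      exact h
    · rw [hs, Matrix.mul_assoc, Matrix.mul_assoc, hts, Matrix.mul_one, ← Matrix.mul_assoc, hts,
        Matrix.one_mul]

lemma norm_diag_eq_one {g : Matrix (Fin 2) (Fin 2) ℚ_[p]} (hg : g ∈ GL2Z p)
    (h : ‖g 0 1 * g 1 0‖ < 1) : ‖g 0 0‖ = 1 ∧ ‖g 1 1‖ = 1 := by
  have hdet := hg.2
  rw [det_fin_two] at hdet
  have hprod : 1 ≤ ‖g 0 0‖ * ‖g 1 1‖ := by
    by_contra! hlt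
    rw [← norm_mul] at hlt
    exact ((norm_sub_le_max p _ _).trans_lt (max_lt hlt h)).ne hdet
  have h0 := hg.1 0 0
  have h1 := hg.1 1 1
  constructor <;> nlinarith [norm_nonneg (g 0 0), norm_nonneg (g 1 1)]

/-- A criterion for `Ht p t = Gamma0upper p`, given the inverse `s` of `t`. -/
lemma Ht_eq_Gamma0upper {s t : Matrix (Fin 4) (Fin 4) ℚ_[p]} (ht : t ∈ Kp p) (hst : s * t = 1)
    (h₁ : ∀ g n q r, IsIwahoriMod p (s * siegelMat p g n q r * t) → ‖g 0 1‖ < 1)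
    (h₂ : ∀ g ∈ GL2Z p, ‖g 0 1‖ < 1 → ‖g 1 1‖ = 1 → ∃ n q r : ℚ_[p],
      ‖n‖ ≤ 1 ∧ ‖q‖ ≤ 1 ∧ ‖r‖ ≤ 1 ∧ IsIwahoriMod p (s * siegelMat p g n q r * t)) :
    Ht p t = Gamma0upper p := by
  ext g
  rw [mem_Ht_iff p ht hst]
  refine and_congr_right fun hg => ⟨fun ⟨n, q, r, _, _, _, h⟩ => h₁ g n q r h, fun hb => ?_⟩
  refine h₂ g hg hb (norm_diag_eq_one p hg ?_).2
  rw [mul_comm]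
  exact norm_mul_lt_one p (hg.1 1 0) hb

/-- A criterion for `Ht p t = Gamma0lower p`, given the inverse `s` of `t`. -/
lemma Ht_eq_Gamma0lower {s t : Matrix (Fin 4) (Fin 4) ℚ_[p]} (ht : t ∈ Kp p) (hst : s * t = 1)
    (h₁ : ∀ g n q r, IsIwahoriMod p (s * siegelMat p g n q r * t) → ‖g 1 0‖ < 1)
    (h₂ : ∀ g ∈ GL2Z p, ‖g 1 0‖ < 1 → ‖g 0 0‖ = 1 → ∃ n q r : ℚ_[p],
      ‖n‖ ≤ 1 ∧ ‖q‖ ≤ 1 ∧ ‖r‖ ≤ 1 ∧ IsIwahoriMod p (s * siegelMat p g n q r * t)) :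
    Ht p t = Gamma0lower p := by
  ext g
  rw [mem_Ht_iff p ht hst]
  refine and_congr_right fun hg => ⟨fun ⟨n, q, r, _, _, _, h⟩ => h₁ g n q r h, fun hc => ?_⟩
  exact h₂ g hg hc (norm_diag_eq_one p hg (norm_mul_lt_one p (hg.1 0 1) hc)).1

lemma Jmat_Umat_Jmat_mem_Kp {n q r : ℚ_[p]} (hn : ‖n‖ ≤ 1) (hq : ‖q‖ ≤ 1) (hr : ‖r‖ ≤ 1) :
    Jmat p * Umat p n q r * Jmat p ∈ Kp p :=
  mul_mem_Kp p (mul_mem_Kp p (Jmat_mem_Kp p) (Umat_mem_Kp p hn hq hr)) (Jmat_mem_Kp p)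

lemma t1_eq : t1 p = !![-1, 0, 0, 0; 0, -1, 0, 0; 1, 0, -1, 0; 0, 0, 0, -1] := by
  ext i j
  fin_cases i <;> fin_cases j <;> simp [t1, Jmat, Umat, Zmat, mul_apply, Fin.sum_univ_succ]

lemma t2_eq : t2 p = !![0, -1, 0, 0; -1, 0, 0, 0; 0, 1, 0, -1; 0, 0, -1, 0] := by
  ext i j
  fin_cases i <;> fin_cases j <;> simp [t2, Jmat, Umat, Zinf, mul_apply, Fin.sum_univ_succ]

lemma t3_eq : t3 p = !![-1, 0, 0, 0; 0, -1, 0, 0; 0, 0, -1, 0; 0, 1, 0, -1] := by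
  ext i j
  fin_cases i <;> fin_cases j <;> simp [t3, Jmat, Umat, Zmat, mul_apply, Fin.sum_univ_succ]

lemma t4_eq : t4 p = !![0, -1, 0, 0; -1, 0, 0, 0; 0, 0, 0, -1; 1, 0, -1, 0] := by
  ext i j
  fin_cases i <;> fin_cases j <;> simp [t4, Jmat, Umat, Zinf, mul_apply, Fin.sum_univ_succ]

lemma t5_eq : t5 p = !![-1, 0, 0, 0; 0, -1, 0, 0; 0, 0, -1, 0; 0, 0, 0, -1] := by
  ext i j
  fin_cases i <;> fin_cases j <;> simp [t5, Jmat, Umat, Zmat, mul_apply, Fin.sum_univ_succ]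

lemma t6_eq : t6 p = !![0, -1, 0, 0; -1, 0, 0, 0; 0, 0, 0, -1; 0, 0, -1, 0] := by
  ext i j
  fin_cases i <;> fin_cases j <;> simp [t6, Jmat, Umat, Zinf, mul_apply, Fin.sum_univ_succ]

lemma t7_eq : t7 p = !![0, 0, 1, 0; 0, 0, 0, 1; -1, 0, 0, 0; 0, -1, 0, 0] := by
  ext i j
  fin_cases i <;> fin_cases j <;> simp [t7, Jmat, Umat, Zmat, mul_apply, Fin.sum_univ_succ]

lemma t8_eq : t8 p = !![0, 0, 0, 1; 0, 0, 1, 0; 0, -1, 0, 0; -1, 0, 0, 0] := by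
  ext i j
  fin_cases i <;> fin_cases j <;> simp [t8, Jmat, Umat, Zinf, mul_apply, Fin.sum_univ_succ]

lemma Ht_t1 : Ht p (t1 p) = Gamma0upper p := by
  have ht : t1 p ∈ Kp p :=
    mul_mem_Kp p (Jmat_Umat_Jmat_mem_Kp p (by simp) (by simp) (by simp))
      (Zmat_mem_Kp p (by simp))
  have hst : !![-1, 0, 0, 0; 0, -1, 0, 0; -1, 0, -1, 0; 0, 0, 0, -1] * t1 p = 1 := by
    rw [t1_eq]
    ext i j
    fin_cases i <;> fin_cases j <;> simp [mul_apply, Fin.sum_univ_succ]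
  refine Ht_eq_Gamma0upper p ht hst (fun g n q r h => ?_) fun g hg hlt hd => ?_
  · simp [t1_eq, IsIwahoriMod, siegelMat, mul_apply, Fin.sum_univ_succ] at h
    simp_all
  · have h0 : g 1 1 ≠ 0 := norm_ne_zero_iff.1 (hd ▸ one_ne_zero)
    refine ⟨(g 0 0 - g 1 1) / g 1 1, 0, 0,
      norm_div_le_one p (norm_sub_le_one p (hg.1 _ _) (hg.1 _ _)) hd, by simp, by simp, ?_⟩
    simp [t1_eq, IsIwahoriMod, siegelMat, mul_apply, Fin.sum_univ_succ, hlt]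
    field_simp
    ring_nf
    simp

lemma Ht_t2 : Ht p (t2 p) = Gamma0upper p := by
  have ht : t2 p ∈ Kp p :=
    mul_mem_Kp p (Jmat_Umat_Jmat_mem_Kp p (by simp) (by simp) (by simp)) (Zinf_mem_Kp p)
  have hst : !![0, -1, 0, 0; -1, 0, 0, 0; 0, 0, 0, -1; -1, 0, -1, 0] * t2 p = 1 := by
    rw [t2_eq]
    ext i j
    fin_cases i <;> fin_cases j <;> simp [mul_apply, Fin.sum_univ_succ]
  refine Ht_eq_Gamma0upper p ht hst (fun g n q r h => ?_) fun g hg hlt hd => ?_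
  · simp [t2_eq, IsIwahoriMod, siegelMat, mul_apply, Fin.sum_univ_succ] at h
    simp_all
  · have h0 : g 1 1 ≠ 0 := norm_ne_zero_iff.1 (hd ▸ one_ne_zero)
    refine ⟨(g 0 0 - g 1 1) / g 1 1, g 1 0 / g 1 1, 0,
      norm_div_le_one p (norm_sub_le_one p (hg.1 _ _) (hg.1 _ _)) hd,
      norm_div_le_one p (hg.1 _ _) hd, by simp, ?_⟩
    simp [t2_eq, IsIwahoriMod, siegelMat, mul_apply, Fin.sum_univ_succ, hlt]
    field_simp
    simp [hd]
    refine lt_of_eq_of_lt (congrArg _ ?_) (norm_mul_lt_one p (hg.1 1 0) hlt)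
    ring

lemma Ht_t3 : Ht p (t3 p) = Gamma0lower p := by
  have ht : t3 p ∈ Kp p :=
    mul_mem_Kp p (Jmat_Umat_Jmat_mem_Kp p (by simp) (by simp) (by simp))
      (Zmat_mem_Kp p (by simp))
  have hst : !![-1, 0, 0, 0; 0, -1, 0, 0; 0, 0, -1, 0; 0, -1, 0, -1] * t3 p = 1 := by
    rw [t3_eq]
    ext i j
    fin_cases i <;> fin_cases j <;> simp [mul_apply, Fin.sum_univ_succ]
  refine Ht_eq_Gamma0lower p ht hst (fun g n q r h => ?_) fun g hg hlt hd => ?_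
  · simp [t3_eq, IsIwahoriMod, siegelMat, mul_apply, Fin.sum_univ_succ] at h
    simp_all
  · have h0 : g 0 0 ≠ 0 := norm_ne_zero_iff.1 (hd ▸ one_ne_zero)
    refine ⟨0, g 0 1 / g 0 0, (g 1 1 - g 0 0) / g 0 0,
      by simp, norm_div_le_one p (hg.1 _ _) hd,
      norm_div_le_one p (norm_sub_le_one p (hg.1 _ _) (hg.1 _ _)) hd, ?_⟩
    simp [t3_eq, IsIwahoriMod, siegelMat, mul_apply, Fin.sum_univ_succ, hlt]
    field_simp
    simp [hd]
    refine lt_of_eq_of_lt (congrArg _ ?_) (norm_mul_lt_one p (hg.1 0 1) hlt)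
    ring

lemma Ht_t4 : Ht p (t4 p) = Gamma0lower p := by
  have ht : t4 p ∈ Kp p :=
    mul_mem_Kp p (Jmat_Umat_Jmat_mem_Kp p (by simp) (by simp) (by simp)) (Zinf_mem_Kp p)
  have hst : !![0, -1, 0, 0; -1, 0, 0, 0; 0, -1, 0, -1; 0, 0, -1, 0] * t4 p = 1 := by
    rw [t4_eq]
    ext i j
    fin_cases i <;> fin_cases j <;> simp [mul_apply, Fin.sum_univ_succ]
  refine Ht_eq_Gamma0lower p ht hst (fun g n q r h => ?_) fun g hg hlt hd => ?_
  · simp [t4_eq, IsIwahoriMod, siegelMat, mul_apply, Fin.sum_univ_succ] at h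
    simp_all
  · have h0 : g 0 0 ≠ 0 := norm_ne_zero_iff.1 (hd ▸ one_ne_zero)
    refine ⟨0, g 0 1 / g 0 0, (g 1 1 - g 0 0) / g 0 0,
      by simp, norm_div_le_one p (hg.1 _ _) hd,
      norm_div_le_one p (norm_sub_le_one p (hg.1 _ _) (hg.1 _ _)) hd, ?_⟩
    simp [t4_eq, IsIwahoriMod, siegelMat, mul_apply, Fin.sum_univ_succ, hlt]
    field_simp
    simp [hd]
    refine lt_of_eq_of_lt (congrArg _ ?_) (norm_mul_lt_one p (hg.1 0 1) hlt)
    ring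

lemma Ht_t5 : Ht p (t5 p) = Gamma0upper p := by
  have ht : t5 p ∈ Kp p :=
    mul_mem_Kp p (Jmat_Umat_Jmat_mem_Kp p (by simp) (by simp) (by simp))
      (Zmat_mem_Kp p (by simp))
  have hst : !![-1, 0, 0, 0; 0, -1, 0, 0; 0, 0, -1, 0; 0, 0, 0, -1] * t5 p = 1 := by
    rw [t5_eq]
    ext i j
    fin_cases i <;> fin_cases j <;> simp [mul_apply, Fin.sum_univ_succ]
  refine Ht_eq_Gamma0upper p ht hst (fun g n q r h => ?_) fun g hg hlt hd => ?_
  · simp [t5_eq, IsIwahoriMod, siegelMat, mul_apply, Fin.sum_univ_succ] at h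
    simp_all
  · refine ⟨0, 0, 0, by simp, by simp, by simp, ?_⟩
    simp [t5_eq, IsIwahoriMod, siegelMat, mul_apply, Fin.sum_univ_succ, hlt]

lemma Ht_t6 : Ht p (t6 p) = Gamma0lower p := by
  have ht : t6 p ∈ Kp p :=
    mul_mem_Kp p (Jmat_Umat_Jmat_mem_Kp p (by simp) (by simp) (by simp)) (Zinf_mem_Kp p)
  have hst : !![0, -1, 0, 0; -1, 0, 0, 0; 0, 0, 0, -1; 0, 0, -1, 0] * t6 p = 1 := by
    rw [t6_eq]
    ext i j
    fin_cases i <;> fin_cases j <;> simp [mul_apply, Fin.sum_univ_succ]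
  refine Ht_eq_Gamma0lower p ht hst (fun g n q r h => ?_) fun g hg hlt hd => ?_
  · simp [t6_eq, IsIwahoriMod, siegelMat, mul_apply, Fin.sum_univ_succ] at h
    simp_all
  · refine ⟨0, 0, 0, by simp, by simp, by simp, ?_⟩
    simp [t6_eq, IsIwahoriMod, siegelMat, mul_apply, Fin.sum_univ_succ, hlt]

lemma Ht_t7 : Ht p (t7 p) = Gamma0lower p := by
  have ht : t7 p ∈ Kp p :=
    mul_mem_Kp p (mul_mem_Kp p (Umat_mem_Kp p (by simp) (by simp) (by simp)) (Jmat_mem_Kp p))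
      (Zmat_mem_Kp p (by simp))
  have hst : !![0, 0, -1, 0; 0, 0, 0, -1; 1, 0, 0, 0; 0, 1, 0, 0] * t7 p = 1 := by
    rw [t7_eq]
    ext i j
    fin_cases i <;> fin_cases j <;> simp [mul_apply, Fin.sum_univ_succ]
  refine Ht_eq_Gamma0lower p ht hst (fun g n q r h => ?_) fun g hg hlt hd => ?_
  · simp [t7_eq, IsIwahoriMod, siegelMat, mul_apply, Fin.sum_univ_succ] at h
    simp_all
  · refine ⟨0, 0, 0, by simp, by simp, by simp, ?_⟩
    simp [t7_eq, IsIwahoriMod, siegelMat, mul_apply, Fin.sum_univ_succ, hlt]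

lemma Ht_t8 : Ht p (t8 p) = Gamma0upper p := by
  have ht : t8 p ∈ Kp p :=
    mul_mem_Kp p (mul_mem_Kp p (Umat_mem_Kp p (by simp) (by simp) (by simp)) (Jmat_mem_Kp p))
      (Zinf_mem_Kp p)
  have hst : !![0, 0, 0, -1; 0, 0, -1, 0; 0, 1, 0, 0; 1, 0, 0, 0] * t8 p = 1 := by
    rw [t8_eq]
    ext i j
    fin_cases i <;> fin_cases j <;> simp [mul_apply, Fin.sum_univ_succ]
  refine Ht_eq_Gamma0upper p ht hst (fun g n q r h => ?_) fun g hg hlt hd => ?_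
  · simp [t8_eq, IsIwahoriMod, siegelMat, mul_apply, Fin.sum_univ_succ] at h
    simp_all
  · refine ⟨0, 0, 0, by simp, by simp, by simp, ?_⟩
    simp [t8_eq, IsIwahoriMod, siegelMat, mul_apply, Fin.sum_univ_succ, hlt]

theorem Ht_determination :
    Ht p (t1 p) = Gamma0upper p ∧ Ht p (t2 p) = Gamma0upper p ∧
    Ht p (t5 p) = Gamma0upper p ∧ Ht p (t8 p) = Gamma0upper p ∧
    Ht p (t3 p) = Gamma0lower p ∧ Ht p (t4 p) = Gamma0lower p ∧
    Ht p (t6 p) = Gamma0lower p ∧ Ht p (t7 p) = Gamma0lower p :=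
  ⟨Ht_t1 p, Ht_t2 p, Ht_t5 p, Ht_t8 p, Ht_t3 p, Ht_t4 p, Ht_t6 p, Ht_t7 p⟩
end
end

section
/- Let h₂(m) = diag(p^m, 1) ∈ GL₂(ℚ_p). Then for every integer m ≥ 0: T(ℚ_p) ∩ h₂(m)·Γ⁰_p·h₂(m)⁻¹ = {x + p^{m+1}·y·ξ : x, y ∈ ℤ_p} ∩ GL₂(ℤ_p), and T(ℚ_p) ∩ h₂(m)·Γ_{0,p}·h₂(m)⁻¹ = {x + p^{max(m,1)}·y·ξ : x, y ∈ ℤ_p} ∩ GL₂(ℤ_p). -/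
open Matrix

noncomputable section

variable (p : ℕ) [Fact p.Prime]

variable (a b c : ℚ_[p])

/-- `h₂(m) = diag(p^m, 1)`. -/
def h2 (m : ℕ) : Matrix (Fin 2) (Fin 2) ℚ_[p] :=
  diagonal ![(p : ℚ_[p]) ^ m, 1]

/-- An element of the torus is a linear combination of `1` and `ξ`. -/
lemma exists_eq_smul_one_add_smul_xiS (ha : a ≠ 0) (hc : c ≠ 0)
    {g : Matrix (Fin 2) (Fin 2) ℚ_[p]} (hg : g ∈ Tgrp p a b c) :
    ∃ x y : ℚ_[p], g = x • (1 : Matrix (Fin 2) (Fin 2) ℚ_[p]) + y • xiS p a b c := by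
  obtain ⟨hdet, h⟩ := hg
  replace hdet := hdet.ne_zero
  have h00 := congrFun₂ h 0 0
  have h01 := congrFun₂ h 0 1
  have h11 := congrFun₂ h 1 1
  simp only [Smat, Matrix.mul_apply, Fin.sum_univ_two, Matrix.transpose_apply, Matrix.smul_apply,
    Matrix.of_apply, Matrix.cons_val', Matrix.cons_val_zero, Matrix.cons_val_one,
    Matrix.cons_val_fin_one, smul_eq_mul, Matrix.det_fin_two] at h00 h01 h11 hdet
  have hanti : a * g 0 1 = -(c * g 1 0) := by
    apply mul_left_cancel₀ hdet
    linear_combination g 1 1 * h01 - g 1 0 * h11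
  have hdiag : a * g 0 0 + b * g 1 0 = a * g 1 1 := by
    apply mul_left_cancel₀ hdet
    linear_combination g 1 1 * h00 - g 1 0 * h01
  refine ⟨g 0 0 - g 0 1 / c * (b / 2), g 0 1 / c, ?_⟩
  have h10 : g 1 0 = -(a * g 0 1 / c) := by
    field_simp
    linear_combination hanti
  have h11' : g 1 1 = g 0 0 - b * g 0 1 / c := by
    apply mul_left_cancel₀ ha
    rw [h10] at hdiag
    linear_combination -hdiag
  ext i j
  fin_cases i <;> fin_cases j
  · simp [xiS]
  · simp [xiS, hc]
  · simp [xiS, h10]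
    ring
  · simp [xiS, h11']
    ring

/-- Invertible linear combinations of `1` and `ξ` lie in the torus. -/
lemma smul_one_add_smul_xiS_mem_Tgrp (x y : ℚ_[p])
    (h : (x • (1 : Matrix (Fin 2) (Fin 2) ℚ_[p]) + y • xiS p a b c).det ≠ 0) :
    x • (1 : Matrix (Fin 2) (Fin 2) ℚ_[p]) + y • xiS p a b c ∈ Tgrp p a b c := by
  refine ⟨h.isUnit, ?_⟩
  ext i j
  fin_cases i <;> fin_cases j <;>
    simp [Smat, xiS, Matrix.mul_apply, Fin.sum_univ_two, Matrix.det_fin_two] <;> ring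

lemma h2_mul_mul_inv (m : ℕ) (k : Matrix (Fin 2) (Fin 2) ℚ_[p]) :
    h2 p m * k * (h2 p m)⁻¹
      = !![k 0 0, (p : ℚ_[p]) ^ m * k 0 1; ((p : ℚ_[p]) ^ m)⁻¹ * k 1 0, k 1 1] := by
  have hp : (p : ℚ_[p]) ^ m ≠ 0 :=
    pow_ne_zero _ (Nat.cast_ne_zero.mpr (Fact.out : p.Prime).ne_zero)
  have hinv : (h2 p m)⁻¹ = diagonal ![((p : ℚ_[p]) ^ m)⁻¹, 1] := by
    apply Matrix.inv_eq_right_inv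
    ext i j
    fin_cases i <;> fin_cases j <;> simp [h2, hp]
  rw [hinv]
  ext i j
  fin_cases i <;> fin_cases j <;> simp [h2, hp, mul_comm]

/-- Membership in an `h₂(m)`-conjugate, for subsets of `GL₂(ℚ_p)` cut out by their entries. -/
lemma exists_eq_h2_mul_mul_inv_iff (m : ℕ) (K : Set (Matrix (Fin 2) (Fin 2) ℚ_[p]))
    (g : Matrix (Fin 2) (Fin 2) ℚ_[p]) :
    (∃ k ∈ K, g = h2 p m * k * (h2 p m)⁻¹) ↔
      !![g 0 0, ((p : ℚ_[p]) ^ m)⁻¹ * g 0 1; (p : ℚ_[p]) ^ m * g 1 0, g 1 1] ∈ K := by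
  have hp : (p : ℚ_[p]) ^ m ≠ 0 :=
    pow_ne_zero _ (Nat.cast_ne_zero.mpr (Fact.out : p.Prime).ne_zero)
  constructor
  · rintro ⟨k, hk, rfl⟩
    rw [h2_mul_mul_inv]
    convert hk
    ext i j
    fin_cases i <;> fin_cases j <;> simp [hp]
  · intro h
    refine ⟨_, h, ?_⟩
    rw [h2_mul_mul_inv]
    ext i j
    fin_cases i <;> fin_cases j <;> simp [hp]

lemma mem_GL2Z_iff (g : Matrix (Fin 2) (Fin 2) ℚ_[p]) :
    g ∈ GL2Z p ↔ (‖g 0 0‖ ≤ 1 ∧ ‖g 0 1‖ ≤ 1 ∧ ‖g 1 0‖ ≤ 1 ∧ ‖g 1 1‖ ≤ 1) ∧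
      ‖g 0 0 * g 1 1 - g 0 1 * g 1 0‖ = 1 := by
  simp [GL2Z, Fin.forall_fin_two, Matrix.det_fin_two, and_assoc]

lemma norm_inv_pow_mul_le_one_iff (n : ℕ) (y : ℚ_[p]) :
    ‖((p : ℚ_[p]) ^ n)⁻¹ * y‖ ≤ 1 ↔ ‖y‖ ≤ ‖(p : ℚ_[p]) ^ n‖ := by
  have hp : 0 < ‖(p : ℚ_[p]) ^ n‖ :=
    norm_pos_iff.mpr (pow_ne_zero _ (Nat.cast_ne_zero.mpr (Fact.out : p.Prime).ne_zero))
  rw [norm_mul, norm_inv, inv_mul_le_one₀ hp]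

lemma norm_lt_one_iff_le_norm_p (y : ℚ_[p]) : ‖y‖ < 1 ↔ ‖y‖ ≤ ‖(p : ℚ_[p])‖ := by
  have := Padic.norm_le_pow_iff_norm_lt_pow_add_one y (-1)
  simpa using this.symm

lemma norm_inv_pow_mul_lt_one_iff (n : ℕ) (y : ℚ_[p]) :
    ‖((p : ℚ_[p]) ^ n)⁻¹ * y‖ < 1 ↔ ‖y‖ ≤ ‖(p : ℚ_[p]) ^ (n + 1)‖ := by
  have hp : 0 < ‖(p : ℚ_[p]) ^ n‖ :=
    norm_pos_iff.mpr (pow_ne_zero _ (Nat.cast_ne_zero.mpr (Fact.out : p.Prime).ne_zero))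
  rw [norm_lt_one_iff_le_norm_p, norm_mul, norm_inv, inv_mul_le_iff₀ hp, pow_succ, norm_mul]

/-- This covers `p = 2`, where `b / 2` need not be integral. -/
lemma norm_mul_half_le_one {y : ℚ_[p]} (hb : ‖b‖ ≤ 1) (hy : ‖y‖ ≤ ‖(p : ℚ_[p])‖) :
    ‖y * (b / 2)‖ ≤ 1 := by
  have h2 : ‖(p : ℚ_[p])‖ ≤ ‖(2 : ℚ_[p])‖ := by
    rcases eq_or_ne p 2 with h | h
    · subst h; simp
    · have h2 : ‖((2 : ℕ) : ℚ_[p])‖ = 1 := by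
        rw [Padic.norm_natCast_eq_one_iff]
        exact (Nat.coprime_primes Fact.out Nat.prime_two).mpr h
      rw [Nat.cast_ofNat] at h2
      rw [h2]
      exact Padic.norm_p_lt_one.le
  have h0 : 0 < ‖(2 : ℚ_[p])‖ := norm_pos_iff.mpr two_ne_zero
  rw [norm_mul, norm_div, ← mul_div_assoc, div_le_one h0]
  calc ‖y‖ * ‖b‖ ≤ ‖y‖ * 1 := by gcongr
    _ ≤ ‖(2 : ℚ_[p])‖ := by linarith

/-- If membership in the conjugate of `K` is equivalent to integrality together with divisibility
by `p ^ n` of the `ξ`-coordinate, then the torus meets the conjugate in the units of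
`ℤ_p + p ^ n ξ ℤ_p`. -/
lemma Tgrp_inter_conj_eq (ha : ‖a‖ = 1) (hb : ‖b‖ ≤ 1) (hc : ‖c‖ = 1) (m : ℕ) {n : ℕ} (hn : n ≠ 0)
    (K : Set (Matrix (Fin 2) (Fin 2) ℚ_[p]))
    (hK : ∀ g : Matrix (Fin 2) (Fin 2) ℚ_[p], ‖g 0 1‖ = ‖g 1 0‖ →
      (!![g 0 0, ((p : ℚ_[p]) ^ m)⁻¹ * g 0 1; (p : ℚ_[p]) ^ m * g 1 0, g 1 1] ∈ K ↔
        g ∈ GL2Z p ∧ ‖g 0 1‖ ≤ ‖(p : ℚ_[p]) ^ n‖)) :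
    Tgrp p a b c ∩ {g | ∃ k ∈ K, g = h2 p m * k * (h2 p m)⁻¹}
      = {g | ∃ x y : ℚ_[p], ‖x‖ ≤ 1 ∧ ‖y‖ ≤ 1 ∧
          g = x • (1 : Matrix (Fin 2) (Fin 2) ℚ_[p])
            + ((p : ℚ_[p]) ^ n * y) • xiS p a b c} ∩ GL2Z p := by
  have ha0 : a ≠ 0 := norm_ne_zero_iff.mp (by simp [ha])
  have hc0 : c ≠ 0 := norm_ne_zero_iff.mp (by simp [hc])
  have hp : (p : ℚ_[p]) ^ n ≠ 0 :=
    pow_ne_zero _ (Nat.cast_ne_zero.mpr (Fact.out : p.Prime).ne_zero)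
  have h01 (x y : ℚ_[p]) :
      ‖(x • (1 : Matrix (Fin 2) (Fin 2) ℚ_[p]) + y • xiS p a b c) 0 1‖ = ‖y‖ := by
    simp [xiS, hc]
  have h10 (x y : ℚ_[p]) :
      ‖(x • (1 : Matrix (Fin 2) (Fin 2) ℚ_[p]) + y • xiS p a b c) 1 0‖ = ‖y‖ := by
    simp [xiS, ha]
  ext g
  simp only [Set.mem_inter_iff, Set.mem_ofPred_eq, exists_eq_h2_mul_mul_inv_iff]
  constructor
  · rintro ⟨hT, hg⟩
    obtain ⟨x, y, rfl⟩ := exists_eq_smul_one_add_smul_xiS p a b c ha0 hc0 hT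
    rw [hK _ ((h01 x y).trans (h10 x y).symm), h01] at hg
    obtain ⟨hZ, hy⟩ := hg
    have hyp : ‖y‖ ≤ ‖(p : ℚ_[p])‖ := by
      refine hy.trans ?_
      rw [norm_pow]
      exact pow_le_of_le_one (norm_nonneg _) Padic.norm_p_lt_one.le hn
    refine ⟨⟨x, ((p : ℚ_[p]) ^ n)⁻¹ * y, ?_, (norm_inv_pow_mul_le_one_iff p n y).mpr hy, ?_⟩, hZ⟩
    · have hx : x = (x • (1 : Matrix (Fin 2) (Fin 2) ℚ_[p]) + y • xiS p a b c) 0 0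
          - y * (b / 2) := by simp [xiS]
      rw [hx]
      rw [sub_eq_add_neg]
      exact (Padic.nonarchimedean _ _).trans
        (max_le (hZ.1 0 0) ((norm_neg _).trans_le (norm_mul_half_le_one p b hb hyp)))
    · rw [mul_inv_cancel_left₀ hp]
  · rintro ⟨⟨x, y, -, hy, rfl⟩, hZ⟩
    have hdet : ‖Matrix.det _‖ = 1 := hZ.2
    refine ⟨smul_one_add_smul_xiS_mem_Tgrp p a b c _ _ (norm_ne_zero_iff.mp (by simp [hdet])), ?_⟩
    rw [hK _ ((h01 _ _).trans (h10 _ _).symm), h01]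
    refine ⟨hZ, ?_⟩
    rw [norm_mul]
    exact mul_le_of_le_one_right (norm_nonneg _) hy

theorem torus_conjugate_intersections
    (ha : ‖a‖ = 1) (hb : ‖b‖ ≤ 1) (hc : ‖c‖ = 1)
    (hd : ‖b ^ 2 - 4 * a * c‖ = 1)
    (hnsq : ∀ z : ℚ_[p], z ^ 2 ≠ b ^ 2 - 4 * a * c)
    (m : ℕ) :
    Tgrp p a b c ∩ {g | ∃ k ∈ Gamma0upper p, g = h2 p m * k * (h2 p m)⁻¹}
      = {g | ∃ x y : ℚ_[p], ‖x‖ ≤ 1 ∧ ‖y‖ ≤ 1 ∧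
          g = x • (1 : Matrix (Fin 2) (Fin 2) ℚ_[p])
            + ((p : ℚ_[p]) ^ (m + 1) * y) • xiS p a b c} ∩ GL2Z p ∧
    Tgrp p a b c ∩ {g | ∃ k ∈ Gamma0lower p, g = h2 p m * k * (h2 p m)⁻¹}
      = {g | ∃ x y : ℚ_[p], ‖x‖ ≤ 1 ∧ ‖y‖ ≤ 1 ∧
          g = x • (1 : Matrix (Fin 2) (Fin 2) ℚ_[p])
            + ((p : ℚ_[p]) ^ (max m 1) * y) • xiS p a b c} ∩ GL2Z p := by
  have hp0 : (p : ℚ_[p]) ^ m ≠ 0 :=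
    pow_ne_zero _ (Nat.cast_ne_zero.mpr (Fact.out : p.Prime).ne_zero)
  have hp1 (n : ℕ) : ‖(p : ℚ_[p]) ^ n‖ ≤ 1 := by
    rw [norm_pow]
    exact pow_le_one₀ (norm_nonneg _) Padic.norm_p_lt_one.le
  have hdet (x y z w : ℚ_[p]) :
      x * w - ((p : ℚ_[p]) ^ m)⁻¹ * y * ((p : ℚ_[p]) ^ m * z) = x * w - y * z := by
    field_simp
  constructor
  · refine Tgrp_inter_conj_eq p a b c ha hb hc m m.succ_ne_zero _ fun g hg => ?_
    simp only [Gamma0upper, Set.mem_ofPred_eq, mem_GL2Z_iff, Matrix.of_apply, Matrix.cons_val',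
      Matrix.cons_val_zero, Matrix.cons_val_one, Matrix.cons_val_fin_one, hdet,
      norm_inv_pow_mul_lt_one_iff]
    constructor
    · rintro ⟨⟨⟨h1, -, -, h4⟩, h5⟩, h6⟩
      have := h6.trans (hp1 _)
      exact ⟨⟨⟨h1, this, hg ▸ this, h4⟩, h5⟩, h6⟩
    · rintro ⟨⟨⟨h1, -, h3, h4⟩, h5⟩, h6⟩
      refine ⟨⟨⟨h1, ((norm_inv_pow_mul_lt_one_iff p m _).mpr h6).le, ?_, h4⟩, h5⟩, h6⟩
      rw [norm_mul]
      exact mul_le_one₀ (hp1 m) (norm_nonneg _) h3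
  · refine Tgrp_inter_conj_eq p a b c ha hb hc m (by lia) _ fun g hg => ?_
    simp only [Gamma0lower, Set.mem_ofPred_eq, mem_GL2Z_iff, Matrix.of_apply, Matrix.cons_val',
      Matrix.cons_val_zero, Matrix.cons_val_one, Matrix.cons_val_fin_one, hdet,
      norm_inv_pow_mul_le_one_iff]
    have key : ‖g 0 1‖ ≤ ‖(p : ℚ_[p]) ^ max m 1‖ ↔
        ‖g 0 1‖ ≤ ‖(p : ℚ_[p]) ^ m‖ ∧ ‖(p : ℚ_[p]) ^ m * g 1 0‖ < 1 := by
      rw [norm_mul, ← hg]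
      rcases Nat.eq_zero_or_pos m with rfl | hm
      · simpa only [Nat.zero_max, pow_zero, pow_one, norm_one, one_mul, ← norm_lt_one_iff_le_norm_p,
          iff_and_self] using le_of_lt
      · rw [max_eq_left hm, iff_self_and]
        have hlt : ‖(p : ℚ_[p]) ^ m‖ < 1 := by
          rw [norm_pow]
          exact pow_lt_one₀ (norm_nonneg _) Padic.norm_p_lt_one hm.ne'
        exact fun h => mul_lt_one_of_nonneg_of_lt_one_left (norm_nonneg _) hlt (h.trans hlt.le)
    rw [key]
    constructor
    · rintro ⟨⟨⟨h1, h2, -, h4⟩, h5⟩, h6⟩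
      have := h2.trans (hp1 _)
      exact ⟨⟨⟨h1, this, hg ▸ this, h4⟩, h5⟩, h2, h6⟩
    · rintro ⟨⟨⟨h1, -, -, h4⟩, h5⟩, h2, h6⟩
      exact ⟨⟨⟨h1, h2, h6.le, h4⟩, h5⟩, h6⟩
end
end

section
/- Under the stated Bessel transformation property, the following vanishing holds for every integer m ≥ 0: B(h(l,m)·t₇) = 0 and B(h(l,m)·t₈) = 0 whenever l ≤ −2; B(h(l,m)·t₁) = 0 and B(h(l,m)·t₂) = 0 whenever l ≤ −1; B(h(l,m)·t₃) = 0 and B(h(l,m)·t₄) = 0 whenever l ≤ −2, and also when l = −1 and m = 0; B(h(l,m)·t₅) = 0 and B(h(l,m)·t₆) = 0 whenever l ≤ −1. -/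
open Matrix

noncomputable section

variable (p : ℕ) [Fact p.Prime]

/-- `Z_v` for `v ∈ V = Y ∪ {∞}`, where `Y = {0,…,p−1}` is modelled by `Fin p`
and `∞` by `none`. -/
def ZV : Option (Fin p) → Matrix (Fin 4) (Fin 4) ℚ_[p]
  | some y => Zmat p (y.val : ℚ_[p])
  | none => Zinf p

/-- Class A matrices `A_x^y = U_x · J · Z_y`. -/
def Amat (x : Fin p × Fin p × Fin p) (v : Option (Fin p)) : Matrix (Fin 4) (Fin 4) ℚ_[p] :=
  Umat p (x.1.val : ℚ_[p]) (x.2.1.val : ℚ_[p]) (x.2.2.val : ℚ_[p]) * Jmat p * ZV p v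

/-- Class B matrices `B_x^y = J · U_x · J · Z_y`. -/
def Bmat (x : Fin p × Fin p × Fin p) (v : Option (Fin p)) : Matrix (Fin 4) (Fin 4) ℚ_[p] :=
  Jmat p * Umat p (x.1.val : ℚ_[p]) (x.2.1.val : ℚ_[p]) (x.2.2.val : ℚ_[p]) * Jmat p * ZV p v

variable (a b c : ℚ_[p])

/-- The Atkin–Lehner element `η_p`. -/
def etamat : Matrix (Fin 4) (Fin 4) ℚ_[p] :=
  !![0,0,0,1; 0,0,1,0; 0,(p:ℚ_[p]),0,0; (p:ℚ_[p]),0,0,0]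

/-- `R_y` for `y ∈ V`: `R_y = (U_{(y,0,0)})ᵀ` for `y ∈ Y` and the given matrix for `y = ∞`. -/
def RV : Option (Fin p) → Matrix (Fin 4) (Fin 4) ℚ_[p]
  | some y => (Umat p (y.val : ℚ_[p]) 0 0)ᵀ
  | none => !![0,0,-1,0; 0,-1,0,0; -1,0,0,0; 0,0,0,1]

/-- The image of two elements of `SL₂` under the embedding `SL₂ × SL₂ → Sp₄`. -/
def sl2Pair (α β γ δ α' β' γ' δ' : ℚ_[p]) : Matrix (Fin 4) (Fin 4) ℚ_[p] :=
  !![α,0,β,0; 0,α',0,β'; γ,0,δ,0; 0,γ',0,δ']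

lemma sl2Pair_mem_Ip {α β γ δ α' β' γ' δ' : ℚ_[p]}
    (hdet : α * δ - β * γ = 1) (hdet' : α' * δ' - β' * γ' = 1)
    (hα : ‖α‖ ≤ 1) (hβ : ‖β‖ ≤ 1) (hγ : ‖γ‖ < 1) (hδ : ‖δ‖ ≤ 1)
    (hα' : ‖α'‖ ≤ 1) (hβ' : ‖β'‖ ≤ 1) (hγ' : ‖γ'‖ < 1) (hδ' : ‖δ'‖ ≤ 1) :
    sl2Pair p α β γ δ α' β' γ' δ' ∈ Ip p := by
  have hD : (sl2Pair p α β γ δ α' β' γ' δ').det = 1 := by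
    have h : (sl2Pair p α β γ δ α' β' γ' δ').det
        = (α * δ - β * γ) * (α' * δ' - β' * γ') := by
      simp [sl2Pair, det_succ_row_zero, Fin.sum_univ_succ, Fin.succAbove]
      ring
    rw [h, hdet, hdet', one_mul]
  refine ⟨⟨⟨by simp [hD], 1, ?_⟩, ?_, by simp [hD]⟩, ?_⟩
  · ext i j
    fin_cases i <;> fin_cases j <;>
      simp [sl2Pair, Jmat, Matrix.mul_apply, Fin.sum_univ_succ] <;>
      first
        | ring1
        | linear_combination hdet
        | linear_combination hdet'
        | linear_combination -hdet
        | linear_combination -hdet'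
  · intro i j
    fin_cases i <;> fin_cases j <;> simp [sl2Pair, hα, hβ, hγ.le, hδ, hα', hβ', hγ'.le, hδ']
  · simp [sl2Pair, hγ, hγ']

lemma blk_mul_hmat (n r : ℚ_[p]) (l : ℤ) (m : ℕ) :
    blk p 1 (diagonal ![n * (p : ℚ_[p]) ^ (2 * (m : ℤ) + l), r * (p : ℚ_[p]) ^ l]) 0 1
        * hmat p l m
      = hmat p l m * Umat p n 0 r := by
  have hp : (p : ℚ_[p]) ≠ 0 := Nat.cast_ne_zero.mpr (Fact.out : p.Prime).ne_zero
  have e : blk p 1 (diagonal ![n * (p : ℚ_[p]) ^ (2 * (m : ℤ) + l), r * (p : ℚ_[p]) ^ l]) 0 1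
      = Umat p (n * (p : ℚ_[p]) ^ (2 * (m : ℤ) + l)) 0 (r * (p : ℚ_[p]) ^ l) := by
    ext i j
    fin_cases i <;> fin_cases j <;> rfl
  rw [e]
  ext i j
  fin_cases i <;> fin_cases j <;>
    simp [hmat, Umat, Matrix.mul_apply, Matrix.diagonal_apply, zpow_add₀ hp] <;> ring

/-- If `h(l,m)·t` is fixed, up to right translation by `I_p`, by a unipotent element on which the
Bessel character is nontrivial, then `B` vanishes there. -/
lemma eq_zero_of_stabilized {B : Matrix (Fin 4) (Fin 4) ℚ_[p] → ℂ} {ψ : ℚ_[p] → ℂ}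
    {Λ : Matrix (Fin 2) (Fin 2) ℚ_[p] → ℂ}
    (hΛone : Λ 1 = 1)
    (hBessel : ∀ t ∈ Tgrp p a b c, ∀ X : Matrix (Fin 2) (Fin 2) ℚ_[p], Xᵀ = X →
      ∀ g : Matrix (Fin 4) (Fin 4) ℚ_[p], ∀ k ∈ Ip p,
      B (emb p t * blk p 1 X 0 1 * g * k) = Λ t * ψ ((Smat p a b c * X).trace) * B g)
    {l : ℤ} {m : ℕ} {n r : ℚ_[p]}
    (hψ : ψ (a * (n * (p : ℚ_[p]) ^ (2 * (m : ℤ) + l)) + c * (r * (p : ℚ_[p]) ^ l)) ≠ 1)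
    {t k : Matrix (Fin 4) (Fin 4) ℚ_[p]} (hk : k ∈ Ip p) (ht : Umat p n 0 r * t * k = t) :
    B (hmat p l m * t) = 0 := by
  have hT : (1 : Matrix (Fin 2) (Fin 2) ℚ_[p]) ∈ Tgrp p a b c := by simp [Tgrp]
  have hemb : emb p 1 = 1 := by simp [emb, blk, fromBlocks_one]
  have h := hBessel 1 hT
    (diagonal ![n * (p : ℚ_[p]) ^ (2 * (m : ℤ) + l), r * (p : ℚ_[p]) ^ l])
    (diagonal_transpose _) (hmat p l m * t) k hk
  have htr : (Smat p a b c *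
      diagonal ![n * (p : ℚ_[p]) ^ (2 * (m : ℤ) + l), r * (p : ℚ_[p]) ^ l]).trace
      = a * (n * (p : ℚ_[p]) ^ (2 * (m : ℤ) + l)) + c * (r * (p : ℚ_[p]) ^ l) := by
    rw [trace_fin_two, mul_diagonal, mul_diagonal]
    simp [Smat, mul_comm]
  rw [hemb, one_mul, ← Matrix.mul_assoc, blk_mul_hmat, Matrix.mul_assoc (hmat p l m),
    Matrix.mul_assoc (hmat p l m), ht, hΛone, one_mul, htr] at h
  by_contra hB
  exact hψ (mul_right_cancel₀ hB (by rw [one_mul]; exact h.symm))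

lemma Umat_eq_sl2Pair (n r : ℚ_[p]) : Umat p n 0 r = sl2Pair p 1 n 0 1 1 r 0 1 := rfl

lemma Jmat_eq_sl2Pair : Jmat p = sl2Pair p 0 1 (-1) 0 0 1 (-1) 0 := rfl

lemma sl2Pair_mul (α β γ δ α' β' γ' δ' ε ζ η θ ε' ζ' η' θ' : ℚ_[p]) :
    sl2Pair p α β γ δ α' β' γ' δ' * sl2Pair p ε ζ η θ ε' ζ' η' θ'
      = sl2Pair p (α * ε + β * η) (α * ζ + β * θ) (γ * ε + δ * η) (γ * ζ + δ * θ)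
          (α' * ε' + β' * η') (α' * ζ' + β' * θ') (γ' * ε' + δ' * η') (γ' * ζ' + δ' * θ') := by
  ext i j
  fin_cases i <;> fin_cases j <;>
    simp [sl2Pair, Matrix.mul_apply, Fin.sum_univ_succ]

lemma Zinf_mul_sl2Pair (α β γ δ α' β' γ' δ' : ℚ_[p]) :
    Zinf p * sl2Pair p α β γ δ α' β' γ' δ' = sl2Pair p α' β' γ' δ' α β γ δ * Zinf p := by
  ext i j
  fin_cases i <;> fin_cases j <;>
    simp [sl2Pair, Zinf, Matrix.mul_apply, Fin.sum_univ_succ]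

lemma Zmat_zero : Zmat p 0 = 1 := by
  ext i j
  fin_cases i <;> fin_cases j <;> simp [Zmat]

lemma Umat_mul_mul_Zinf_mul {n r α β γ δ α' β' γ' δ' : ℚ_[p]}
    {t : Matrix (Fin 4) (Fin 4) ℚ_[p]}
    (h : Umat p n 0 r * t * sl2Pair p α β γ δ α' β' γ' δ' = t) :
    Umat p n 0 r * (t * Zinf p) * sl2Pair p α' β' γ' δ' α β γ δ = t * Zinf p := by
  rw [← Matrix.mul_assoc, Matrix.mul_assoc _ (Zinf p), Zinf_mul_sl2Pair, ← Matrix.mul_assoc, h]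

lemma norm_div_mul_zpow_neg_le {x u : ℚ_[p]} (hx : ‖x‖ ≤ p) (hu : ‖u‖ = 1) (l : ℤ) :
    ‖x / u * (p : ℚ_[p]) ^ (-l)‖ ≤ (p : ℝ) ^ (l + 1) := by
  have hp : (0 : ℝ) < p := Nat.cast_pos.mpr (Fact.out : p.Prime).pos
  rw [norm_mul, norm_div, hu, div_one, Padic.norm_p_zpow, neg_neg, zpow_add_one₀ hp.ne',
    mul_comm]
  gcongr

theorem bessel_vanishing
    (ha : ‖a‖ = 1) (hb : ‖b‖ ≤ 1) (hc : ‖c‖ = 1)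
    (hd : ‖b ^ 2 - 4 * a * c‖ = 1)
    (hnsq : ∀ z : ℚ_[p], z ^ 2 ≠ b ^ 2 - 4 * a * c)
    (B : Matrix (Fin 4) (Fin 4) ℚ_[p] → ℂ) (ψ : ℚ_[p] → ℂ)
    (Λ : Matrix (Fin 2) (Fin 2) ℚ_[p] → ℂ)
    (hψadd : ∀ x y : ℚ_[p], ψ (x + y) = ψ x * ψ y)
    (hψtriv : ∀ x : ℚ_[p], ‖x‖ ≤ 1 → ψ x = 1)
    (hψnontriv : ∃ x : ℚ_[p], ‖x‖ ≤ p ∧ ψ x ≠ 1)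
    (hΛmul : ∀ s t, s ∈ Tgrp p a b c → t ∈ Tgrp p a b c → Λ (s * t) = Λ s * Λ t)
    (hΛne : ∀ t ∈ Tgrp p a b c, Λ t ≠ 0)
    (hΛscalar : ∀ z : ℚ_[p], z ≠ 0 → Λ (z • (1 : Matrix (Fin 2) (Fin 2) ℚ_[p])) = 1)
    (hΛtriv : ∀ x y : ℚ_[p], ‖x‖ ≤ 1 → ‖y‖ < 1 →
      (x • (1 : Matrix (Fin 2) (Fin 2) ℚ_[p]) + y • xiS p a b c) ∈ GL2Z p →
      Λ (x • (1 : Matrix (Fin 2) (Fin 2) ℚ_[p]) + y • xiS p a b c) = 1)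
    (hBessel : ∀ t ∈ Tgrp p a b c, ∀ X : Matrix (Fin 2) (Fin 2) ℚ_[p], Xᵀ = X →
      ∀ g : Matrix (Fin 4) (Fin 4) ℚ_[p], ∀ k ∈ Ip p,
      B (emb p t * blk p 1 X 0 1 * g * k) = Λ t * ψ ((Smat p a b c * X).trace) * B g) :
    ∀ (l : ℤ) (m : ℕ),
      (l ≤ -2 → B (hmat p l m * t7 p) = 0 ∧ B (hmat p l m * t8 p) = 0) ∧
      (l ≤ -1 → B (hmat p l m * t1 p) = 0 ∧ B (hmat p l m * t2 p) = 0) ∧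
      ((l ≤ -2 ∨ (l = -1 ∧ m = 0)) →
        B (hmat p l m * t3 p) = 0 ∧ B (hmat p l m * t4 p) = 0) ∧
      (l ≤ -1 → B (hmat p l m * t5 p) = 0 ∧ B (hmat p l m * t6 p) = 0) := by
  intro l m
  obtain ⟨x, hx, hψx⟩ := hψnontriv
  have hp : (p : ℚ_[p]) ≠ 0 := Nat.cast_ne_zero.mpr (Fact.out : p.Prime).ne_zero
  have hp1 : (1 : ℝ) < p := Nat.one_lt_cast.mpr (Fact.out : p.Prime).one_lt
  have ha0 : a ≠ 0 := norm_ne_zero_iff.mp (by simp [ha])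
  have hc0 : c ≠ 0 := norm_ne_zero_iff.mp (by simp [hc])
  have hΛone : Λ 1 = 1 := by simpa using hΛscalar 1 one_ne_zero
  obtain ⟨r, hr⟩ : ∃ r, r = x / c * (p : ℚ_[p]) ^ (-l) := ⟨_, rfl⟩
  have hrnorm : ‖r‖ ≤ (p : ℝ) ^ (l + 1) := hr ▸ norm_div_mul_zpow_neg_le p hx hc l
  have hrle : l ≤ -1 → ‖r‖ ≤ 1 := fun hl =>
    hrnorm.trans (zpow_le_one_of_nonpos₀ hp1.le (by omega))
  have hrlt : l ≤ -2 → ‖r‖ < 1 := fun hl =>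
    hrnorm.trans_lt (zpow_lt_one_of_neg₀ hp1 (by omega))
  have hψr : ψ (a * (0 * (p : ℚ_[p]) ^ (2 * (m : ℤ) + l)) + c * (r * (p : ℚ_[p]) ^ l)) ≠ 1 := by
    have : a * (0 * (p : ℚ_[p]) ^ (2 * (m : ℤ) + l)) + c * (r * (p : ℚ_[p]) ^ l) = x := by
      rw [hr, _root_.zpow_neg]
      field_simp
      simp
    rwa [this]
  have vanish {t k} := eq_zero_of_stabilized p a b c hΛone hBessel hψr (t := t) (k := k)
  have hadd {s : ℚ_[p]} (hs : ‖s‖ ≤ 1) : ‖1 + s‖ ≤ 1 :=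
    (Padic.nonarchimedean 1 s).trans (by simp [hs])
  have hsub {s : ℚ_[p]} (hs : ‖s‖ ≤ 1) : ‖1 - s‖ ≤ 1 := by
    rw [sub_eq_add_neg]
    exact hadd (by rwa [norm_neg])
  refine ⟨fun hl => ?_, fun hl => ?_, ?_, fun hl => ?_⟩
  · have hs : Umat p 0 0 r * (Umat p 0 0 0 * Jmat p)
          * sl2Pair p 1 0 0 1 1 0 r 1 = Umat p 0 0 0 * Jmat p := by
      simp [Umat_eq_sl2Pair, Jmat_eq_sl2Pair, sl2Pair_mul]
    simp only [t7, t8, Zmat_zero, mul_one]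
    exact ⟨vanish (by apply sl2Pair_mem_Ip <;> simp [hrlt hl]) hs,
      vanish (by apply sl2Pair_mem_Ip <;> simp [hrlt hl]) (Umat_mul_mul_Zinf_mul p hs)⟩
  · have hs : Umat p 0 0 r * (Jmat p * Umat p 1 0 0 * Jmat p)
          * sl2Pair p 1 0 0 1 1 (-r) 0 1 = Jmat p * Umat p 1 0 0 * Jmat p := by
      simp [Umat_eq_sl2Pair, Jmat_eq_sl2Pair, sl2Pair_mul]
    simp only [t1, t2, Zmat_zero, mul_one]
    exact ⟨vanish (by apply sl2Pair_mem_Ip <;> simp [hrle hl]) hs,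
      vanish (by apply sl2Pair_mem_Ip <;> simp [hrle hl]) (Umat_mul_mul_Zinf_mul p hs)⟩
  · rintro (hl | ⟨rfl, rfl⟩)
    · have hr1 := hrlt hl
      have hs : Umat p 0 0 r * (Jmat p * Umat p 0 0 1 * Jmat p)
          * sl2Pair p 1 0 0 1 (1 + r) (-r) r (1 - r) = Jmat p * Umat p 0 0 1 * Jmat p := by
        simp [Umat_eq_sl2Pair, Jmat_eq_sl2Pair, sl2Pair_mul]
        congr 1 <;> ring
      simp only [t3, t4, Zmat_zero, mul_one]
      exact ⟨vanish (by apply sl2Pair_mem_Ip <;> simp [hr1, hr1.le, hadd, hsub]; ring) hs,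
        vanish (by apply sl2Pair_mem_Ip <;> simp [hr1, hr1.le, hadd, hsub]; ring)
          (Umat_mul_mul_Zinf_mul p hs)⟩
    · obtain ⟨n, hn⟩ : ∃ n, n = x / a * (p : ℚ_[p]) ^ (-(-1 : ℤ)) := ⟨_, rfl⟩
      have hnle : ‖n‖ ≤ 1 := by
        simpa [hn] using norm_div_mul_zpow_neg_le p hx ha (-1)
      have hψn : ψ (a * (n * (p : ℚ_[p]) ^ (2 * ((0 : ℕ) : ℤ) + -1))
          + c * (0 * (p : ℚ_[p]) ^ (-1 : ℤ))) ≠ 1 := by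
        have : a * (n * (p : ℚ_[p]) ^ (2 * ((0 : ℕ) : ℤ) + -1))
            + c * (0 * (p : ℚ_[p]) ^ (-1 : ℤ)) = x := by
          simp [hn]
          field_simp
        rwa [this]
      have vanish' {t k} := eq_zero_of_stabilized p a b c hΛone hBessel hψn (t := t) (k := k)
      have hs : Umat p n 0 0 * (Jmat p * Umat p 0 0 1 * Jmat p)
          * sl2Pair p 1 (-n) 0 1 1 0 0 1 = Jmat p * Umat p 0 0 1 * Jmat p := by
        simp [Umat_eq_sl2Pair, Jmat_eq_sl2Pair, sl2Pair_mul]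
      simp only [t3, t4, Zmat_zero, mul_one]
      exact ⟨vanish' (by apply sl2Pair_mem_Ip <;> simp [hnle]) hs,
        vanish' (by apply sl2Pair_mem_Ip <;> simp [hnle]) (Umat_mul_mul_Zinf_mul p hs)⟩
  · have hs : Umat p 0 0 r * (Jmat p * Umat p 0 0 0 * Jmat p)
          * sl2Pair p 1 0 0 1 1 (-r) 0 1 = Jmat p * Umat p 0 0 0 * Jmat p := by
      simp [Umat_eq_sl2Pair, Jmat_eq_sl2Pair, sl2Pair_mul]
    simp only [t5, t6, Zmat_zero, mul_one]
    exact ⟨vanish (by apply sl2Pair_mem_Ip <;> simp [hrle hl]) hs,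
      vanish (by apply sl2Pair_mem_Ip <;> simp [hrle hl]) (Umat_mul_mul_Zinf_mul p hs)⟩
end
end
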